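/- arXiv:2510.05550 — 3 statements merged into one kernel-verified Lean document; each statement's English description precedes it below -/
import Mathlib

section
/- Let G be a nonempty c-path bounded subset of D, and suppose there is a nonempty finite subset Ω of G such that for every (x,y) ∈ G there exists a path in G from (x,y) to some point (x_e,y_e) ∈ Ω. Then the function f : G → [−∞,+∞] defined by f(x,y) := sup over (x_e,y_e) ∈ Ω of F_G((x,y),(x_e,y_e)) is real-valued and is a c-antiderivative of G. -/
open scoped BigOperators

namespace Paper

variable {X Y : Type*}

/-- The domain of the cost `c`, i.e. the set where `c` is finite. -/
def Dom (c : X × Y → EReal) : Set (X × Y) := {p | c p < ⊤}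

/-- `z` is a path in `G` from `p` to `q` (with `N` steps). -/
def IsPath (c : X × Y → EReal) (G : Set (X × Y)) (p q : X × Y)
    (N : ℕ) (z : Fin (N + 1) → X × Y) : Prop :=
  (∀ k, z k ∈ G) ∧ z 0 = p ∧ z (Fin.last N) = q ∧
    ∀ k : Fin N, c ((z k.succ).1, (z k.castSucc).2) < ⊤

/-- The inner variation `∑_{k=1}^N (c(x_k,y_k) − c(x_{k+1},y_k))` along a path; all the
terms involved are finite for a path in `G ⊆ Dom c`, so the real-valued sum is faithful. -/
noncomputable def pathSum (c : X × Y → EReal) {N : ℕ} (z : Fin (N + 1) → X × Y) : ℝ :=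
  ∑ k : Fin N, ((c (z k.castSucc)).toReal - (c ((z k.succ).1, (z k.castSucc).2)).toReal)

/-- The maximal inner variation `F_G(p,q)`, with the convention `sSup ∅ = ⊥ = −∞`. -/
noncomputable def innerVar (c : X × Y → EReal) (G : Set (X × Y)) (p q : X × Y) : EReal :=
  sSup {s : EReal | ∃ (N : ℕ) (z : Fin (N + 1) → X × Y),
    IsPath c G p q N z ∧ s = ((pathSum c z : ℝ) : EReal)}

/-- `G` is `c`-path bounded. -/
def PathBounded (c : X × Y → EReal) (G : Set (X × Y)) : Prop :=
  ∀ p ∈ G, ∀ q ∈ G, innerVar c G p q < ⊤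

/-- `G` is `c`-cyclically monotone. -/
def CyclicallyMonotone (c : X × Y → EReal) (G : Set (X × Y)) : Prop :=
  ∀ p ∈ G, innerVar c G p p ≤ 0

/-- `f` is a `c`-antiderivative of `G`:
`c(x,y) − c(u,y) ≤ f(x,y) − f(u,v)` in `[−∞,+∞]` for all `(x,y),(u,v) ∈ G`. -/
def IsAntideriv (c : X × Y → EReal) (G : Set (X × Y)) (f : X × Y → ℝ) : Prop :=
  ∀ p ∈ G, ∀ q ∈ G, c p - c (q.1, p.2) ≤ (f p : EReal) - (f q : EReal)

/-- `p` and `q` are strongly connected (mutually reachable by paths) in `G`. -/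
def StronglyConn (c : X × Y → EReal) (G : Set (X × Y)) (p q : X × Y) : Prop :=
  (∃ N z, IsPath c G p q N z) ∧ (∃ N z, IsPath c G q p N z)

theorem IsPath.cons {c : X × Y → EReal} {G : Set (X × Y)} {p q w : X × Y} {N : ℕ}
    {z : Fin (N + 1) → X × Y} (hz : IsPath c G q w N z) (hp : p ∈ G)
    (hpq : c (q.1, p.2) < ⊤) :
    IsPath c G p w (N + 1) (Fin.cons p z) := by
  obtain ⟨hG, h0, hlast, hfin⟩ := hz
  refine ⟨Fin.cases hp hG, rfl, ?_, Fin.cases ?_ fun k => ?_⟩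
  · rw [← Fin.succ_last, Fin.cons_succ, hlast]
  · simpa [h0] using hpq
  · simpa [← Fin.succ_castSucc] using hfin k

theorem pathSum_cons (c : X × Y → EReal) (p : X × Y) {N : ℕ} (z : Fin (N + 1) → X × Y) :
    pathSum c (Fin.cons p z : Fin (N + 1 + 1) → X × Y) =
      ((c p).toReal - (c ((z 0).1, p.2)).toReal) + pathSum c z := by
  simp [pathSum, Fin.sum_univ_succ (n := N)]

theorem IsPath.pathSum_le_innerVar {c : X × Y → EReal} {G : Set (X × Y)} {p q : X × Y} {N : ℕ}
    {z : Fin (N + 1) → X × Y} (hz : IsPath c G p q N z) :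
    ((pathSum c z : ℝ) : EReal) ≤ innerVar c G p q :=
  le_sSup ⟨N, z, hz, rfl⟩

/-- if every point of `G` is joined by a path to a point of a nonempty
finite `Ω ⊆ G`, then `f(p) = sup_{q ∈ Ω} F_G(p,q)` is real-valued and a `c`-antiderivative. -/
theorem antideriv_of_finite_target (c : X × Y → EReal) (hbot : ∀ p, c p ≠ ⊥)
    (G : Set (X × Y)) (hne : G.Nonempty) (hGD : G ⊆ Dom c)
    (hpb : PathBounded c G)
    (Ω : Set (X × Y)) (hΩne : Ω.Nonempty) (hΩfin : Ω.Finite) (hΩG : Ω ⊆ G)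
    (hreach : ∀ p ∈ G, ∃ q ∈ Ω, ∃ (N : ℕ) (z : Fin (N + 1) → X × Y), IsPath c G p q N z) :
    (∀ p ∈ G, ∃ r : ℝ, (⨆ q ∈ Ω, innerVar c G p q) = (r : EReal)) ∧
      IsAntideriv c G (fun p => (⨆ q ∈ Ω, innerVar c G p q).toReal) := by
  have hreal : ∀ p ∈ G, ∃ r : ℝ, (⨆ q ∈ Ω, innerVar c G p q) = (r : EReal) := by
    intro p hp
    have htop : (⨆ q ∈ Ω, innerVar c G p q) < ⊤ := by
      obtain ⟨q, hq, hsup⟩ := (hΩne.image (innerVar c G p)).csSup_mem (hΩfin.image _)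
      rw [← sSup_image, ← hsup]
      exact hpb p hp q (hΩG hq)
    have hne_bot : (⨆ q ∈ Ω, innerVar c G p q) ≠ ⊥ := by
      obtain ⟨q, hq, N, z, hz⟩ := hreach p hp
      exact ((EReal.bot_lt_coe _).trans_le
        (hz.pathSum_le_innerVar.trans (le_iSup₂ (f := fun q _ => innerVar c G p q) q hq))).ne'
    exact ⟨_, (EReal.coe_toReal htop.ne hne_bot).symm⟩
  refine ⟨hreal, fun p hp q hq => ?_⟩
  obtain ⟨r, hr⟩ := hreal p hp
  obtain ⟨s, hs⟩ := hreal q hq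
  simp only [hr, hs, EReal.toReal_coe]
  have hcp := EReal.coe_toReal (hGD hp).ne (hbot p)
  by_cases hpq : c (q.1, p.2) = ⊤
  · simp [hpq]
  have hcq := EReal.coe_toReal hpq (hbot _)
  suffices h : s ≤ r - ((c p).toReal - (c (q.1, p.2)).toReal) by
    rw [← hcp, ← hcq]
    norm_cast
    linarith
  rw [← EReal.coe_le_coe_iff, ← hs]
  refine iSup₂_le fun w hw => sSup_le ?_
  rintro _ ⟨N, z, hz, rfl⟩
  have hle := (hz.cons hp (lt_top_iff_ne_top.2 hpq)).pathSum_le_innerVar.trans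
    (le_iSup₂ (f := fun q _ => innerVar c G p q) w hw)
  rw [hr, EReal.coe_le_coe_iff, pathSum_cons, hz.2.1] at hle
  rw [EReal.coe_le_coe_iff]
  linarith

end Paper
end

section
/- Let G be a nonempty c-path bounded subset of D, and suppose there is a nonempty finite subset A of G such that for every (x,y) ∈ G there exist a point (x_s,y_s) ∈ A and a path in G from (x_s,y_s) to (x,y). Then the function f : G → [−∞,+∞] defined by f(x,y) := − sup over (x_s,y_s) ∈ A of F_G((x_s,y_s),(x,y)) is real-valued and is a c-antiderivative of G. -/
open scoped BigOperators

namespace Paper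

variable {X Y : Type*}

theorem IsPath.snoc {c : X × Y → EReal} {G : Set (X × Y)} {a p q : X × Y} {N : ℕ}
    {z : Fin (N + 1) → X × Y} (hz : IsPath c G a p N z) (hq : q ∈ G)
    (hc : c (q.1, p.2) < ⊤) :
    IsPath c G a q (N + 1) (Fin.snoc (α := fun _ => X × Y) z q) := by
  obtain ⟨hG, h0, hl, hs⟩ := hz
  refine ⟨fun k => ?_, ?_, by simp, fun k => ?_⟩
  · refine Fin.lastCases ?_ (fun k => ?_) k
    · simpa using hq
    · simpa using hG k
  · rw [← Fin.castSucc_zero, Fin.snoc_castSucc, h0]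
  · refine Fin.lastCases ?_ (fun k => ?_) k
    · simpa [hl] using hc
    · rw [Fin.succ_castSucc, Fin.snoc_castSucc, Fin.snoc_castSucc]
      exact hs k

theorem pathSum_snoc (c : X × Y → EReal) {N : ℕ} (z : Fin (N + 1) → X × Y) (q : X × Y) :
    pathSum c (Fin.snoc (α := fun _ => X × Y) z q) = pathSum c z +
      ((c (z (Fin.last N))).toReal - (c (q.1, (z (Fin.last N)).2)).toReal) := by
  simp only [pathSum]
  rw [Fin.sum_univ_castSucc]
  simp only [Fin.succ_castSucc, Fin.snoc_castSucc, Fin.succ_last, Fin.snoc_last]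

/-- if every point of `G` is reachable by a path from a point of a nonempty
finite `A ⊆ G`, then `f(p) = − sup_{q ∈ A} F_G(q,p)` is real-valued and a `c`-antiderivative. -/
theorem antideriv_of_finite_source (c : X × Y → EReal) (hbot : ∀ p, c p ≠ ⊥)
    (G : Set (X × Y)) (hne : G.Nonempty) (hGD : G ⊆ Dom c)
    (hpb : PathBounded c G)
    (A : Set (X × Y)) (hAne : A.Nonempty) (hAfin : A.Finite) (hAG : A ⊆ G)
    (hreach : ∀ p ∈ G, ∃ q ∈ A, ∃ (N : ℕ) (z : Fin (N + 1) → X × Y), IsPath c G q p N z) :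
    (∀ p ∈ G, ∃ r : ℝ, (-(⨆ q ∈ A, innerVar c G q p)) = (r : EReal)) ∧
      IsAntideriv c G (fun p => (-(⨆ q ∈ A, innerVar c G q p)).toReal) := by
  have key : ∀ p ∈ G, ∃ r : ℝ, (⨆ q ∈ A, innerVar c G q p) = (r : EReal) := by
    intro p hp
    have htop : (⨆ q ∈ A, innerVar c G q p) < ⊤ := by
      obtain ⟨a, ha, hmax⟩ := Set.exists_max_image A (fun q => innerVar c G q p) hAfin hAne
      exact (iSup₂_le hmax).trans_lt (hpb a (hAG ha) p hp)
    have hbot' : ⊥ < ⨆ q ∈ A, innerVar c G q p := by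
      obtain ⟨a, ha, N, z, hz⟩ := hreach p hp
      exact (EReal.bot_lt_coe _).trans_le (hz.pathSum_le_innerVar.trans
        (le_iSup₂ (f := fun q (_ : q ∈ A) => innerVar c G q p) a ha))
    exact ⟨_, (EReal.coe_toReal htop.ne hbot'.ne').symm⟩
  refine ⟨fun p hp => ?_, fun p hp q hq => ?_⟩
  · obtain ⟨r, hr⟩ := key p hp
    exact ⟨-r, by rw [hr, EReal.coe_neg]⟩
  · obtain ⟨r, hr⟩ := key p hp
    obtain ⟨s, hs⟩ := key q hq
    simp only [hr, hs, ← EReal.coe_neg, EReal.toReal_coe]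
    have hcp := EReal.coe_toReal (hGD hp : c p < ⊤).ne (hbot p)
    rcases eq_or_ne (c (q.1, p.2)) ⊤ with htop | htop
    · rw [htop, EReal.sub_top]
      exact bot_le
    have hcq := EReal.coe_toReal htop (hbot _)
    have hle : (r : EReal) ≤ ((s - ((c p).toReal - (c (q.1, p.2)).toReal) : ℝ) : EReal) := by
      rw [← hr]
      refine iSup₂_le fun a ha => sSup_le ?_
      rintro _ ⟨N, z, hz, rfl⟩
      have hext := (hz.snoc hq htop.lt_top).pathSum_le_innerVar.trans
        (le_iSup₂ (f := fun a (_ : a ∈ A) => innerVar c G a q) a ha)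
      rw [hs, pathSum_snoc, hz.2.2.1, EReal.coe_le_coe_iff] at hext
      exact EReal.coe_le_coe_iff.2 (by linarith)
    rw [EReal.coe_le_coe_iff] at hle
    rw [← hcp, ← hcq, ← EReal.coe_sub, ← EReal.coe_sub, EReal.coe_le_coe_iff]
    linarith

end Paper
end

section
/- Suppose X and Y are metric spaces and the domain D of c is open in X × Y. Let G be a nonempty subset of D that is topologically connected, or ball chain connected, or strongly connected. If G is c-cyclically monotone, then G is c-path bounded and has a c-antiderivative. -/
open scoped BigOperators

namespace Paper

variable {X Y : Type*}

/-- The ℓ²-product distance `√(d_X(x,u)² + d_Y(y,v)²)` on `X × Y`. -/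
noncomputable def dist2 [PseudoMetricSpace X] [PseudoMetricSpace Y] (p q : X × Y) : ℝ :=
  Real.sqrt (dist p.1 q.1 ^ 2 + dist p.2 q.2 ^ 2)

/-- The open ball for the ℓ²-product distance. -/
def ball2 [PseudoMetricSpace X] [PseudoMetricSpace Y] (p : X × Y) (r : ℝ) : Set (X × Y) :=
  {q | dist2 p q < r}

/-- The maximal open ball centered at `p` contained in `Dom c`, i.e. `B_{ρ(p)}(p)` where
`ρ(p) = sup {r > 0 | B_r(p) ⊆ Dom c}`; note `dist2 p q < ρ(p)` iff there exists `r > 0`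
with `B_r(p) ⊆ Dom c` and `dist2 p q < r`. -/
def MaxBall [PseudoMetricSpace X] [PseudoMetricSpace Y]
    (c : X × Y → EReal) (p : X × Y) : Set (X × Y) :=
  {q | ∃ r : ℝ, 0 < r ∧ ball2 p r ⊆ Dom c ∧ dist2 p q < r}

/-- `z` is a ball chain in `G` from `p` to `q`. -/
def IsBallChain [PseudoMetricSpace X] [PseudoMetricSpace Y]
    (c : X × Y → EReal) (G : Set (X × Y)) (p q : X × Y)
    (N : ℕ) (z : Fin (N + 1) → X × Y) : Prop :=
  (∀ k, z k ∈ G) ∧ z 0 = p ∧ z (Fin.last N) = q ∧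
    ∀ k : Fin N, (MaxBall c (z k.castSucc) ∩ MaxBall c (z k.succ) ∩ G).Nonempty

/-- `Walk c G p q s` says that some path in `G` from `p` to `q` has inner variation `s`. -/
inductive Walk (c : X × Y → EReal) (G : Set (X × Y)) (p : X × Y) : X × Y → ℝ → Prop
  | nil : p ∈ G → Walk c G p p 0
  | snoc {q r : X × Y} {s : ℝ} : Walk c G p q s → r ∈ G → c (r.1, q.2) < ⊤ →
      Walk c G p r (s + ((c q).toReal - (c (r.1, q.2)).toReal))

section Walk

variable {c : X × Y → EReal} {G : Set (X × Y)}

theorem Walk.trans {p q r : X × Y} {s t : ℝ} (h : Walk c G p q s) (h' : Walk c G q r t) :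
    Walk c G p r (s + t) := by
  induction h' with
  | nil => simpa using h
  | snoc _ hr hc ih => rw [← add_assoc]; exact ih.snoc hr hc

theorem Walk.of_isPath {p q : X × Y} {N : ℕ} {z : Fin (N + 1) → X × Y}
    (h : IsPath c G p q N z) : Walk c G p q (pathSum c z) := by
  induction N generalizing q with
  | zero =>
    obtain ⟨hG, rfl, rfl, -⟩ := h
    simpa [pathSum] using Walk.nil (c := c) (hG 0)
  | succ N ih =>
    obtain ⟨hG, hp, rfl, hc⟩ := h
    have hw := (ih (q := z (Fin.last N).castSucc) (z := fun k => z k.castSucc)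
      ⟨fun k => hG _, by simpa using hp, rfl, fun k => hc k.castSucc⟩).snoc
        (hG (Fin.last (N + 1))) (hc (Fin.last N))
    rw [pathSum, Fin.sum_univ_castSucc]
    exact hw

theorem Walk.exists_isPath {p q : X × Y} {s : ℝ} (h : Walk c G p q s) :
    ∃ (N : ℕ) (z : Fin (N + 1) → X × Y), IsPath c G p q N z ∧ pathSum c z = s := by
  induction h with
  | nil hp => exact ⟨0, fun _ => p, ⟨fun _ => hp, rfl, rfl, fun k => k.elim0⟩, by simp [pathSum]⟩
  | @snoc q r s _ hr hc ih =>
    obtain ⟨N, z, ⟨hG, hp, rfl, hz⟩, rfl⟩ := ih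
    refine ⟨N + 1, Fin.snoc (α := fun _ => X × Y) z r, ⟨fun k => ?_, ?_, by simp, fun k => ?_⟩, ?_⟩
    · refine Fin.lastCases ?_ (fun k => ?_) k
      · simpa using hr
      · simpa using hG k
    · rw [← Fin.castSucc_zero, Fin.snoc_castSucc, hp]
    · refine Fin.lastCases ?_ (fun k => ?_) k
      · simpa using hc
      · rw [← Fin.castSucc_succ, Fin.snoc_castSucc, Fin.snoc_castSucc]
        exact hz k
    · rw [pathSum, Fin.sum_univ_castSucc, Fin.succ_last, Fin.snoc_last, Fin.snoc_castSucc]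
      simp only [← Fin.castSucc_succ, Fin.snoc_castSucc]
      rfl

theorem Walk.le_innerVar {p q : X × Y} {s : ℝ} (h : Walk c G p q s) :
    (s : EReal) ≤ innerVar c G p q := by
  obtain ⟨N, z, hz, rfl⟩ := h.exists_isPath
  exact le_sSup ⟨N, z, hz, rfl⟩

theorem CyclicallyMonotone.add_nonpos (hcm : CyclicallyMonotone c G) {p q : X × Y} {s t : ℝ}
    (hp : p ∈ G) (h : Walk c G p q s) (h' : Walk c G q p t) : s + t ≤ 0 := by
  exact_mod_cast (h.trans h').le_innerVar.trans (hcm p hp)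

theorem CyclicallyMonotone.pathBounded (hcm : CyclicallyMonotone c G)
    (hG : ∀ p ∈ G, ∀ q ∈ G, ∃ s, Walk c G p q s) : PathBounded c G := by
  intro p hp q hq
  obtain ⟨t, ht⟩ := hG q hq p hp
  refine lt_of_le_of_lt (sSup_le ?_) (EReal.coe_lt_top (-t))
  rintro _ ⟨N, z, hz, rfl⟩
  have := hcm.add_nonpos hp (.of_isPath hz) ht
  exact_mod_cast (by linarith : pathSum c z ≤ -t)

theorem CyclicallyMonotone.exists_isAntideriv (hcm : CyclicallyMonotone c G)
    (hbot : ∀ p, c p ≠ ⊥) (hGD : G ⊆ Dom c) (hne : G.Nonempty)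
    (hG : ∀ p ∈ G, ∀ q ∈ G, ∃ s, Walk c G p q s) :
    ∃ f : X × Y → ℝ, IsAntideriv c G f := by
  obtain ⟨o, ho⟩ := hne
  have hbdd : ∀ q ∈ G, BddAbove {s | Walk c G o q s} := by
    intro q hq
    obtain ⟨t, ht⟩ := hG q hq o ho
    exact ⟨-t, fun s hs => by linarith [hcm.add_nonpos ho hs ht]⟩
  refine ⟨fun q => -sSup {s | Walk c G o q s}, fun p hp q hq => ?_⟩
  have hcp : c p ≠ ⊤ := (hGD hp).ne
  by_cases hc : c (q.1, p.2) = ⊤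
  · rw [hc, EReal.sub_top]
    exact bot_le
  · have key : sSup {s | Walk c G o p s} ≤
        sSup {s | Walk c G o q s} - ((c p).toReal - (c (q.1, p.2)).toReal) := by
      refine csSup_le (hG o ho p hp) fun s hs => ?_
      have := le_csSup (hbdd q hq) (hs.snoc hq (lt_top_iff_ne_top.2 hc))
      linarith
    rw [← EReal.coe_toReal hcp (hbot p), ← EReal.coe_toReal hc (hbot _)]
    norm_cast
    linarith

end Walk

section Connected

variable [PseudoMetricSpace X] [PseudoMetricSpace Y] {c : X × Y → EReal} {G : Set (X × Y)}

theorem mem_dom_of_mem_maxBall {p q : X × Y} (h : q ∈ MaxBall c p) :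
    c (q.1, p.2) < ⊤ ∧ c (p.1, q.2) < ⊤ := by
  obtain ⟨r, -, hr, hpq⟩ := h
  constructor <;> refine hr (lt_of_le_of_lt (Real.sqrt_le_sqrt ?_) hpq) <;> simp

theorem exists_walk_of_isBallChain {p q : X × Y} {N : ℕ} {z : Fin (N + 1) → X × Y}
    (h : IsBallChain c G p q N z) : ∃ s, Walk c G p q s := by
  obtain ⟨hG, rfl, rfl, hz⟩ := h
  refine Fin.induction (motive := fun k => ∃ s, Walk c G (z 0) (z k) s)
    ⟨0, .nil (hG 0)⟩ (fun k ⟨s, hs⟩ => ?_) (Fin.last N)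
  obtain ⟨r, ⟨h₁, h₂⟩, hr⟩ := hz k
  exact ⟨_, (hs.snoc hr (mem_dom_of_mem_maxBall h₁).1).snoc (hG _)
    (mem_dom_of_mem_maxBall h₂).2⟩

end Connected

theorem exists_walk_of_isPreconnected [TopologicalSpace X] [TopologicalSpace Y]
    {c : X × Y → EReal} {G : Set (X × Y)} (hD : IsOpen (Dom c)) (hGD : G ⊆ Dom c)
    (hG : IsPreconnected G) {p q : X × Y} (hp : p ∈ G) (hq : q ∈ G) : ∃ s, Walk c G p q s := by
  refine hG.induction₂' (fun p q => ∃ s, Walk c G p q s) (fun p hp => ?_)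
    (fun _ _ _ _ _ _ ⟨_, h⟩ ⟨_, h'⟩ => ⟨_, h.trans h'⟩) hp hq
  have h₁ : Filter.Tendsto (fun q : X × Y => (q.1, p.2)) (nhds p) (nhds p) :=
    Continuous.tendsto' (by fun_prop) _ _ rfl
  have h₂ : Filter.Tendsto (fun q : X × Y => (p.1, q.2)) (nhds p) (nhds p) :=
    Continuous.tendsto' (by fun_prop) _ _ rfl
  have hU := hD.mem_nhds (hGD hp)
  filter_upwards [self_mem_nhdsWithin, nhdsWithin_le_nhds (h₁ hU), nhdsWithin_le_nhds (h₂ hU)]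
    with q hq hq₁ hq₂
  exact ⟨⟨_, (Walk.nil hp).snoc hq hq₁⟩, ⟨_, (Walk.nil hq).snoc hp hq₂⟩⟩

/-- in metric spaces with open domain, a nonempty subset of the domain that
is topologically connected, or ball chain connected, or strongly connected, and
`c`-cyclically monotone, is `c`-path bounded and has a `c`-antiderivative. -/
theorem pathBounded_antideriv_of_connected [MetricSpace X] [MetricSpace Y]
    (c : X × Y → EReal) (hbot : ∀ p, c p ≠ ⊥) (hD : IsOpen (Dom c))
    (G : Set (X × Y)) (hne : G.Nonempty) (hGD : G ⊆ Dom c)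
    (hconn : IsConnected G ∨
      (∀ p ∈ G, ∀ q ∈ G, ∃ (N : ℕ) (z : Fin (N + 1) → X × Y), IsBallChain c G p q N z) ∨
      (∀ p ∈ G, ∀ q ∈ G, StronglyConn c G p q))
    (hcm : CyclicallyMonotone c G) :
    PathBounded c G ∧ ∃ f : X × Y → ℝ, IsAntideriv c G f := by
  have hG : ∀ p ∈ G, ∀ q ∈ G, ∃ s, Walk c G p q s := by
    intro p hp q hq
    rcases hconn with h | h | h
    · exact exists_walk_of_isPreconnected hD hGD h.isPreconnected hp hq
    · obtain ⟨N, z, hz⟩ := h p hp q hq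
      exact exists_walk_of_isBallChain hz
    · obtain ⟨N, z, hz⟩ := (h p hp q hq).1
      exact ⟨_, .of_isPath hz⟩
  exact ⟨hcm.pathBounded hG, hcm.exists_isAntideriv hbot hGD hne hG⟩

end Paper
end
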